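/- arXiv:2407.04239 — 2 statements merged into one kernel-verified Lean document; each statement's English description precedes it below -/
import Mathlib

section
/- Let a > 0 and b > 1 be real constants and define f : ℝ → ℝ by f(x) = exp(b^x / a). Then the function x ↦ f(x)/x is convex on the open interval (0, ∞). -/
/-- Let `a > 0` and `b > 1` be real constants and
`f x = exp (b ^ x / a)` the double exponential function. Then `x ↦ f x / x`
is convex on the open interval `(0, ∞)`. -/
theorem stmt_2 (a b : ℝ) (ha : 0 < a) (hb : 1 < b) :
    ConvexOn ℝ (Set.Ioi (0 : ℝ)) (fun x : ℝ => Real.exp (b ^ x / a) / x) := by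
  have h_pow : ConvexOn ℝ (Set.Ioi (0 : ℝ)) (fun x : ℝ => a⁻¹ • b ^ x) :=
    ((convexOn_rpow_left (zero_lt_one.trans hb)).subset (Set.subset_univ _)
      (convex_Ioi 0)).smul (inv_nonneg.2 ha.le)
  have h_log := h_pow.sub strictConcaveOn_log_Ioi.concaveOn
  refine ConvexOn.congr (f := fun x : ℝ => Real.exp (a⁻¹ • b ^ x - Real.log x))
    ⟨convex_Ioi 0, fun x hx y hy s t hs ht hst => ?_⟩ fun x hx => ?_
  · exact (Real.exp_le_exp.2 (h_log.2 hx hy hs ht hst)).trans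
      (convexOn_exp.2 (Set.mem_univ _) (Set.mem_univ _) hs ht hst)
  · simp only [smul_eq_mul, Real.exp_sub, Real.exp_log hx, div_eq_inv_mul]
end

section
/- For any bandwidth W > 0 and SNR parameter ρ > 0, the function R ↦ (1/R)·exp((2^{R/W} − 1)/ρ) is convex on the open interval (0, ∞). -/
/-- If `h` is convex on a set of positive reals, then so is `x ↦ (1 / x) * exp (h x)`, because it
is the exponential of the convex function `h - log`. -/
theorem ConvexOn.one_div_mul_exp {s : Set ℝ} {h : ℝ → ℝ} (hh : ConvexOn ℝ s h)
    (hs : s ⊆ Set.Ioi 0) : ConvexOn ℝ s fun x => (1 / x) * Real.exp (h x) := by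
  have hlog : ConcaveOn ℝ s Real.log :=
    strictConcaveOn_log_Ioi.concaveOn.subset hs hh.1
  refine ConvexOn.congr (f := fun x => Real.exp ((h - Real.log) x))
    ⟨hh.1, fun x hx y hy a b ha hb hab => ?_⟩ fun x hx => ?_
  · exact (Real.exp_le_exp.2 ((hh.sub hlog).2 hx hy ha hb hab)).trans
      (convexOn_exp.2 (Set.mem_univ _) (Set.mem_univ _) ha hb hab)
  · simp only [Pi.sub_apply, Real.exp_sub, Real.exp_log (hs hx)]
    ring

/-- For any bandwidth `W > 0` and SNR parameter `ρ > 0`, the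
function `R ↦ (1/R) * exp ((2 ^ (R/W) - 1) / ρ)` is convex on `(0, ∞)`. -/
theorem stmt_3 (W ρ : ℝ) (hW : 0 < W) (hρ : 0 < ρ) :
    ConvexOn ℝ (Set.Ioi (0 : ℝ))
      (fun R : ℝ => (1 / R) * Real.exp (((2 : ℝ) ^ (R / W) - 1) / ρ)) := by
  refine ConvexOn.one_div_mul_exp ⟨convex_Ioi 0, fun x _ y _ a b ha hb hab => ?_⟩ subset_rfl
  have key := convexOn_exp.2 (Set.mem_univ (Real.log 2 * (x / W)))
    (Set.mem_univ (Real.log 2 * (y / W))) ha hb hab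
  simp only [smul_eq_mul, Real.rpow_def_of_pos (zero_lt_two' ℝ)] at key ⊢
  rw [show a * (Real.log 2 * (x / W)) + b * (Real.log 2 * (y / W))
    = Real.log 2 * ((a * x + b * y) / W) by ring] at key
  rw [← mul_div_assoc a, ← mul_div_assoc b, ← add_div]
  gcongr
  linarith
end
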